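/- Let n ≥ 5 and p ≥ n/(n-4), and let u be a nonnegative C⁴ solution of Δ²u = u^p in the punctured ball B₁\{0} ⊂ ℝⁿ. Then u^p is locally integrable on B₁ (i.e., u ∈ L^p_loc(B₁)), and u is a distribution solution of Δ²u = u^p in B₁: for every smooth compactly supported function φ : ℝⁿ → ℝ with support contained in B₁, ∫_{B₁} u Δ²φ dx = ∫_{B₁} u^p φ dx. -/

import Mathlib

open MeasureTheory Metric Filter

/-- The Euclidean Laplacian `Δu` of `u : ℝⁿ → ℝ`, computed as the trace of the second
derivative: `Δu(x) = ∑ i, ∂²u/∂xᵢ²(x)`. -/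
noncomputable def lap {n : ℕ} (u : EuclideanSpace ℝ (Fin n) → ℝ) :
    EuclideanSpace ℝ (Fin n) → ℝ :=
  fun x => ∑ i : Fin n,
    iteratedFDeriv ℝ 2 u x ![EuclideanSpace.single i 1, EuclideanSpace.single i 1]

/-- The biharmonic operator `Δ²u = Δ(Δu)`. -/
noncomputable def bilap {n : ℕ} (u : EuclideanSpace ℝ (Fin n) → ℝ) :
    EuclideanSpace ℝ (Fin n) → ℝ :=
  lap (lap u)

section IteratedDirectionalDerivatives

variable {ι V : Type*} [Fintype ι] [NormedAddCommGroup V] [NormedSpace ℝ V]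

/-- The sum of the second directional derivatives of `F` along the vectors `v i`. -/
noncomputable def lapAlong (v : ι → V) (F : V → ℝ) : V → ℝ :=
  fun x => ∑ i, fderiv ℝ (fun y => fderiv ℝ F y (v i)) x (v i)

theorem ContDiff.fderiv_apply_const {F : V → ℝ} (hF : ContDiff ℝ (⊤ : ℕ∞) F) (w : V) :
    ContDiff ℝ (⊤ : ℕ∞) (fun y => fderiv ℝ F y w) :=
  (hF.fderiv_right (m := (⊤ : ℕ∞)) (by simp)).clm_apply contDiff_const

theorem ContDiff.lapAlong {F : V → ℝ} (hF : ContDiff ℝ (⊤ : ℕ∞) F) (v : ι → V) :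
    ContDiff ℝ (⊤ : ℕ∞) (lapAlong v F) :=
  ContDiff.sum fun i _ => (hF.fderiv_apply_const (v i)).fderiv_apply_const (v i)

theorem fderiv_pow_mul_apply {η g : V → ℝ} (hη : ContDiff ℝ (⊤ : ℕ∞) η)
    (hg : ContDiff ℝ (⊤ : ℕ∞) g) (m : ℕ) (w x : V) :
    fderiv ℝ (fun y => η y ^ (m + 1) * g y) x w =
      η x ^ m * ((m + 1) * fderiv ℝ η x w * g x + η x * fderiv ℝ g x w) := by
  have h1 : DifferentiableAt ℝ η x := hη.differentiable (by simp) x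
  have h2 : DifferentiableAt ℝ g x := hg.differentiable (by simp) x
  have h := ((h1.hasFDerivAt.pow (m + 1)).mul h2.hasFDerivAt).fderiv
  have h' : fderiv ℝ (fun y => η y ^ (m + 1) * g y) x = _ := h
  rw [h']
  simp
  ring

/-- Applying a second-order operator to a multiple of `η ^ (m + 2)` leaves a multiple of
`η ^ m`. -/
theorem exists_lapAlong_pow_mul {η g : V → ℝ} (hη : ContDiff ℝ (⊤ : ℕ∞) η)
    (hg : ContDiff ℝ (⊤ : ℕ∞) g) (m : ℕ) (v : ι → V) :
    ∃ h : V → ℝ, ContDiff ℝ (⊤ : ℕ∞) h ∧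
      lapAlong v (fun y => η y ^ (m + 2) * g y) = fun y => η y ^ m * h y := by
  let G (k : ℕ) (w : V) (g : V → ℝ) : V → ℝ :=
    fun x => (k + 1) * fderiv ℝ η x w * g x + η x * fderiv ℝ g x w
  have hG : ∀ k w g, ContDiff ℝ (⊤ : ℕ∞) g → ContDiff ℝ (⊤ : ℕ∞) (G k w g) := fun k w g hg =>
    ((contDiff_const.mul (hη.fderiv_apply_const w)).mul hg).add
      (hη.mul (hg.fderiv_apply_const w))
  refine ⟨fun x => ∑ i, G m (v i) (G (m + 1) (v i) g) x,
    ContDiff.sum fun i _ => hG _ _ _ (hG _ _ _ hg), ?_⟩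
  funext x
  simp only [lapAlong, Finset.mul_sum]
  refine Finset.sum_congr rfl fun i _ => ?_
  have : (fun y => fderiv ℝ (fun y => η y ^ (m + 2) * g y) y (v i)) =
      fun y => η y ^ (m + 1) * G (m + 1) (v i) g y := by
    funext y
    rw [fderiv_pow_mul_apply hη hg (m + 1)]
  rw [this, fderiv_pow_mul_apply hη (hG _ _ _ hg)]

end IteratedDirectionalDerivatives

section Laplacian

variable {n : ℕ}

local notation "𝔼" => EuclideanSpace ℝ (Fin n)

theorem lap_eq_lapAlong {f : 𝔼 → ℝ} {x : 𝔼} (hf : ContDiffAt ℝ 2 f x) :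
    lap f x = lapAlong (fun i : Fin n => EuclideanSpace.single i (1 : ℝ)) f x := by
  have h : DifferentiableAt ℝ (fderiv ℝ f) x :=
    (hf.fderiv_right (m := 1) (by norm_num)).differentiableAt (by norm_num)
  simp only [lap, lapAlong, iteratedFDeriv_two_apply]
  refine Finset.sum_congr rfl fun i _ => ?_
  rw [fderiv_clm_apply h (differentiableAt_const _)]
  simp

theorem ContDiffAt.lap {f : 𝔼 → ℝ} {x : 𝔼} {k l : ℕ} (hf : ContDiffAt ℝ l f x)
    (h : k + 2 ≤ l) : ContDiffAt ℝ k (lap f) x := by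
  refine ContDiffAt.sum fun i _ => ?_
  exact (ContinuousMultilinearMap.apply ℝ (fun _ : Fin 2 => 𝔼) ℝ _).contDiff.contDiffAt.comp x
    (hf.iteratedFDeriv_right (i := 2) (m := k) (by exact_mod_cast h))

theorem ContDiff.lap {f : 𝔼 → ℝ} (hf : ContDiff ℝ (⊤ : ℕ∞) f) :
    ContDiff ℝ (⊤ : ℕ∞) (lap f) := by
  rw [contDiff_infty]
  intro k
  rw [contDiff_iff_contDiffAt]
  intro x
  exact ((contDiff_infty.1 hf (k + 2)).contDiffAt).lap le_rfl

theorem lap_congr_nhds {f g : 𝔼 → ℝ} {x : 𝔼} (h : f =ᶠ[nhds x] g) :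
    lap f =ᶠ[nhds x] lap g := by
  filter_upwards [h.iteratedFDeriv ℝ 2] with y hy
  simp [lap, hy]

theorem bilap_congr_nhds {f g : 𝔼 → ℝ} {x : 𝔼} (h : f =ᶠ[nhds x] g) :
    bilap f x = bilap g x :=
  (lap_congr_nhds (lap_congr_nhds h)).eq_of_nhds

theorem lap_const (c : ℝ) : lap (fun _ : 𝔼 => c) = fun _ => 0 := by
  funext x
  simp [lap, iteratedFDeriv_two_apply]

theorem support_lap_subset (f : 𝔼 → ℝ) : Function.support (lap f) ⊆ tsupport f := by
  intro x hx
  by_contra h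
  refine hx ?_
  rw [(lap_congr_nhds (notMem_tsupport_iff_eventuallyEq.1 h)).eq_of_nhds]
  exact congrFun (lap_const 0) x

theorem tsupport_lap_subset (f : 𝔼 → ℝ) : tsupport (lap f) ⊆ tsupport f :=
  closure_minimal (support_lap_subset f) (isClosed_tsupport f)

theorem HasCompactSupport.lap {f : 𝔼 → ℝ} (hf : HasCompactSupport f) :
    HasCompactSupport (lap f) :=
  hf.mono' (support_lap_subset f)

theorem lap_comp_smul (f : 𝔼 → ℝ) (c : ℝ) :
    lap (fun x => f (c • x)) = fun x => c ^ 2 * lap f (c • x) := by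
  funext x
  simp only [lap, iteratedFDeriv_two_apply, Finset.mul_sum]
  refine Finset.sum_congr rfl fun i _ => ?_
  have : fderiv ℝ (fun x => f (c • x)) = fun x => c • fderiv ℝ f (c • x) := by
    funext y
    exact fderiv_comp_smul c
  rw [this]
  have h2 : fderiv ℝ (fun x => c • fderiv ℝ f (c • x)) x =
      c • (c • fderiv ℝ (fderiv ℝ f) (c • x)) := by
    rw [← fderiv_comp_smul c]
    exact congrFun (fderiv_const_smul_field (𝕜 := ℝ) c (f := fun x => fderiv ℝ f (c • x))) x
  rw [h2]
  simp
  ring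

theorem lap_const_mul (f : 𝔼 → ℝ) (c : ℝ) : lap (fun x => c * f x) = fun x => c * lap f x := by
  funext x
  simp only [lap, Finset.mul_sum]
  refine Finset.sum_congr rfl fun i _ => ?_
  rcases eq_or_ne c 0 with rfl | hc
  · simp [iteratedFDeriv_two_apply]
  · have : fderiv ℝ (fun x => c * f x) = fun x => c • fderiv ℝ f x := by
      exact fderiv_const_smul_field (𝕜 := ℝ) c (f := f)
    rw [iteratedFDeriv_two_apply, this, iteratedFDeriv_two_apply]
    have h2 : fderiv ℝ (fun x => c • fderiv ℝ f x) x = c • fderiv ℝ (fderiv ℝ f) x :=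
      congrFun (fderiv_const_smul_field (𝕜 := ℝ) c (f := fderiv ℝ f)) x
    rw [h2]
    simp

theorem bilap_comp_smul (f : 𝔼 → ℝ) (c : ℝ) (x : 𝔼) :
    bilap (fun x => f (c • x)) x = c ^ 4 * bilap f (c • x) := by
  simp only [bilap, lap_comp_smul, lap_const_mul]
  ring

theorem lap_slice {F : ℝ × 𝔼 → ℝ} (hF : ContDiff ℝ (⊤ : ℕ∞) F) (t : ℝ) :
    lap (fun y => F (t, y)) = fun y =>
      lapAlong (fun i : Fin n => ((0 : ℝ), EuclideanSpace.single i (1 : ℝ))) F (t, y) := by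
  have key : ∀ G : ℝ × 𝔼 → ℝ, ContDiff ℝ (⊤ : ℕ∞) G → ∀ (w y : 𝔼),
      fderiv ℝ (fun y => G (t, y)) y w = fderiv ℝ G (t, y) (0, w) := by
    intro G hG w y
    have h := ((hG.differentiable (by simp) (t, y)).hasFDerivAt.comp y
      (hasFDerivAt_prodMk_right t y)).fderiv
    have h' : fderiv ℝ (fun y => G (t, y)) y = _ := h
    rw [h']
    simp
  funext y
  have h2 : ContDiff ℝ (⊤ : ℕ∞) (fun y : 𝔼 => F (t, y)) :=
    hF.comp (contDiff_const.prodMk contDiff_id)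
  rw [lap_eq_lapAlong (contDiff_infty.1 h2 2).contDiffAt]
  refine Finset.sum_congr rfl fun i _ => ?_
  simp_rw [key F hF]
  exact key _ (hF.fderiv_apply_const _) _ _

end Laplacian

section IntegrationByParts

theorem integrable_mul_of_tsupport_subset {V : Type*} [TopologicalSpace V] [MeasurableSpace V]
    [OpensMeasurableSpace V] [T2Space V] {μ : Measure V} [IsFiniteMeasureOnCompacts μ]
    {U : Set V} (hU : IsOpen U) {f g : V → ℝ} (hf : ContinuousOn f U) (hg : Continuous g)
    (hgc : HasCompactSupport g) (hgU : tsupport g ⊆ U) : Integrable (fun x => f x * g x) μ := by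
  have hcont : Continuous (fun x => f x * g x) := by
    refine continuous_of_tsupport fun x hx => ?_
    have hx' : x ∈ U := hgU (tsupport_mul_subset_right hx)
    exact (hf.continuousAt (hU.mem_nhds hx')).mul hg.continuousAt
  exact hcont.integrable_of_hasCompactSupport hgc.mul_left

variable {n : ℕ}

local notation "𝔼" => EuclideanSpace ℝ (Fin n)

/-- Green's second identity against a test function supported where `f` is `C²`. -/
theorem integral_mul_lap {U : Set 𝔼} (hU : IsOpen U) {f g : 𝔼 → ℝ}
    (hf : ∀ x ∈ U, ContDiffAt ℝ 2 f x) (hg : ContDiff ℝ (⊤ : ℕ∞) g) (hgc : HasCompactSupport g)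
    (hgU : tsupport g ⊆ U) : ∫ x, f x * lap g x = ∫ x, lap f x * g x := by
  let e : Fin n → 𝔼 := fun i => EuclideanSpace.single i (1 : ℝ)
  have hf0 : ContinuousOn f U := fun x hx => (hf x hx).continuousAt.continuousWithinAt
  have hf1 : ∀ w, ∀ x ∈ U, ContDiffAt ℝ 1 (fun y => fderiv ℝ f y w) x := fun w x hx =>
    ((hf x hx).fderiv_right (m := 1) (by norm_num)).clm_apply contDiffAt_const
  have hf1c : ∀ w, ContinuousOn (fun y => fderiv ℝ f y w) U := fun w x hx =>
    (hf1 w x hx).continuousAt.continuousWithinAt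
  have hf2c : ∀ w, ContinuousOn (fun x => fderiv ℝ (fun y => fderiv ℝ f y w) x w) U :=
    fun w x hx => (((hf1 w x hx).fderiv_right (m := 0) (by norm_num)).clm_apply
      contDiffAt_const).continuousAt.continuousWithinAt
  have supp : ∀ (h : 𝔼 → ℝ) (w : 𝔼), tsupport (fun y => fderiv ℝ h y w) ⊆ tsupport h :=
    fun h w => tsupport_fderiv_apply_subset ℝ w
  have hg1 : ∀ w, ContDiff ℝ (⊤ : ℕ∞) (fun y => fderiv ℝ g y w) := hg.fderiv_apply_const
  have hg1s : ∀ w, tsupport (fun y => fderiv ℝ g y w) ⊆ U := fun w => (supp g w).trans hgU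
  have hg1c : ∀ w, HasCompactSupport (fun y => fderiv ℝ g y w) := fun w =>
    hgc.fderiv_apply ℝ w
  have hg2 : ∀ w, ContDiff ℝ (⊤ : ℕ∞) (fun x => fderiv ℝ (fun y => fderiv ℝ g y w) x w) :=
    fun w => (hg1 w).fderiv_apply_const w
  have hg2s : ∀ w, tsupport (fun x => fderiv ℝ (fun y => fderiv ℝ g y w) x w) ⊆ U :=
    fun w => (supp _ w).trans (hg1s w)
  have hg2c : ∀ w, HasCompactSupport (fun x => fderiv ℝ (fun y => fderiv ℝ g y w) x w) :=
    fun w => (hg1c w).fderiv_apply ℝ w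
  have I0 : ∀ w, Integrable (fun x => f x * fderiv ℝ (fun y => fderiv ℝ g y w) x w) := fun w =>
    integrable_mul_of_tsupport_subset hU hf0 (hg2 w).continuous (hg2c w) (hg2s w)
  have I1 : ∀ w, Integrable (fun x => fderiv ℝ f x w * fderiv ℝ g x w) := fun w =>
    integrable_mul_of_tsupport_subset hU (hf1c w) (hg1 w).continuous (hg1c w) (hg1s w)
  have I2 : ∀ w, Integrable (fun x => fderiv ℝ (fun y => fderiv ℝ f y w) x w * g x) := fun w =>
    integrable_mul_of_tsupport_subset hU (hf2c w) hg.continuous hgc hgU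
  have step : ∀ w, ∫ x, f x * fderiv ℝ (fun y => fderiv ℝ g y w) x w =
      ∫ x, fderiv ℝ (fun y => fderiv ℝ f y w) x w * g x := by
    intro w
    rw [integral_mul_fderiv_eq_neg_fderiv_mul_of_integrable (I1 w) (I0 w)
        (integrable_mul_of_tsupport_subset hU hf0 (hg1 w).continuous (hg1c w) (hg1s w))
        (fun x hx => (hf x (hg1s w hx)).differentiableAt (by norm_num))
        (fun x _ => (hg1 w).differentiable (by simp) x),
      integral_mul_fderiv_eq_neg_fderiv_mul_of_integrable (I2 w) (I1 w)
        (integrable_mul_of_tsupport_subset hU (hf1c w) hg.continuous hgc hgU)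
        (fun x hx => (hf1 w x (hgU hx)).differentiableAt (by norm_num))
        (fun x _ => hg.differentiable (by simp) x), neg_neg]
  have left : ∀ x, f x * lap g x =
      ∑ i, f x * fderiv ℝ (fun y => fderiv ℝ g y (e i)) x (e i) := fun x => by
    rw [lap_eq_lapAlong (contDiff_infty.1 hg 2).contDiffAt, lapAlong, Finset.mul_sum]
  have right : ∀ x, lap f x * g x =
      ∑ i, fderiv ℝ (fun y => fderiv ℝ f y (e i)) x (e i) * g x := fun x => by
    by_cases hx : x ∈ U
    · rw [lap_eq_lapAlong (hf x hx), lapAlong, Finset.sum_mul]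
    · simp [image_eq_zero_of_notMem_tsupport fun h => hx (hgU h)]
  simp_rw [left, right]
  rw [integral_finsetSum _ fun i _ => I0 (e i), integral_finsetSum _ fun i _ => I2 (e i)]
  exact Finset.sum_congr rfl fun i _ => step (e i)

theorem integral_mul_bilap {U : Set 𝔼} (hU : IsOpen U) {f g : 𝔼 → ℝ}
    (hf : ∀ x ∈ U, ContDiffAt ℝ 4 f x) (hg : ContDiff ℝ (⊤ : ℕ∞) g) (hgc : HasCompactSupport g)
    (hgU : tsupport g ⊆ U) : ∫ x, f x * bilap g x = ∫ x, bilap f x * g x := by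
  have h2 : ∀ x ∈ U, ContDiffAt ℝ 2 (lap f) x := fun x hx =>
    ContDiffAt.lap (k := 2) (l := 4) (hf x hx) le_rfl
  unfold bilap
  rw [← integral_mul_lap hU h2 hg hgc hgU, ← integral_mul_lap hU
    (fun x hx => (hf x hx).of_le (by norm_num)) hg.lap hgc.lap ((tsupport_lap_subset g).trans hgU)]

end IntegrationByParts

section Cutoff

variable {n : ℕ}

local notation "𝔼" => EuclideanSpace ℝ (Fin n)

/-- A smooth function with values in `[0, 1]`, equal to `0` on the closed unit ball and to `1`
outside the ball of radius two. -/
structure IsOriginCutoff (η : 𝔼 → ℝ) : Prop where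
  smooth : ContDiff ℝ (⊤ : ℕ∞) η
  nonneg : ∀ x, 0 ≤ η x
  le_one : ∀ x, η x ≤ 1
  eq_zero : ∀ x, ‖x‖ ≤ 1 → η x = 0
  eq_one : ∀ x, 2 ≤ ‖x‖ → η x = 1

theorem exists_isOriginCutoff (n : ℕ) :
    ∃ η : EuclideanSpace ℝ (Fin n) → ℝ, IsOriginCutoff η := by
  let b : ContDiffBump (0 : EuclideanSpace ℝ (Fin n)) := ⟨1, 2, by norm_num, by norm_num⟩
  refine ⟨fun x => 1 - b x, contDiff_const.sub b.contDiff, fun x => ?_, fun x => ?_,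
    fun x hx => ?_, fun x hx => ?_⟩
  · simpa using b.le_one
  · simpa using b.nonneg
  · simp [b.one_of_mem_closedBall (show x ∈ closedBall 0 1 by simpa using hx)]
  · simp [b.zero_of_le_dist (show (2 : ℝ) ≤ dist x 0 by simpa using hx)]

/-- The function `φ` multiplied by the `N`-th power of the cutoff `η` at scale `ε`. -/
noncomputable def truncate (η φ : 𝔼 → ℝ) (N : ℕ) (ε : ℝ) : 𝔼 → ℝ :=
  fun y => φ y * η (ε⁻¹ • y) ^ N

/-- Rescaled cutoffs of a fixed test function lose `ε⁻⁴` under the biharmonic operator, while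
retaining all but four of the powers of the cutoff. -/
theorem exists_abs_bilap_cutoff_le {η φ : 𝔼 → ℝ} (hη : IsOriginCutoff η)
    (hφ : ContDiff ℝ (⊤ : ℕ∞) φ) (m : ℕ) :
    ∃ C : ℝ, 0 ≤ C ∧ ∀ ε : ℝ, 0 < ε → ε ≤ 1 → ∀ x : 𝔼, ‖x‖ ≤ 2 * ε →
      |bilap (truncate η φ (m + 4) ε) x| ≤ C * ε⁻¹ ^ 4 * η (ε⁻¹ • x) ^ m := by
  let v : Fin n → ℝ × 𝔼 := fun i => (0, EuclideanSpace.single i (1 : ℝ))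
  let F : ℝ × 𝔼 → ℝ := fun z => η z.2 ^ (m + 2 + 2) * φ (z.1 • z.2)
  have hη' : ContDiff ℝ (⊤ : ℕ∞) (fun z : ℝ × 𝔼 => η z.2) := hη.smooth.comp contDiff_snd
  have hφ' : ContDiff ℝ (⊤ : ℕ∞) (fun z : ℝ × 𝔼 => φ (z.1 • z.2)) :=
    hφ.comp (contDiff_fst.smul contDiff_snd)
  have hF : ContDiff ℝ (⊤ : ℕ∞) F := (hη'.pow _).mul hφ'
  obtain ⟨h₁, hh₁, e₁⟩ := exists_lapAlong_pow_mul hη' hφ' (m + 2) v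
  obtain ⟨h₂, hh₂, e₂⟩ := exists_lapAlong_pow_mul hη' hh₁ m v
  obtain ⟨C, hC⟩ := ((isCompact_Icc (a := (0 : ℝ)) (b := 1)).prod
    (isCompact_closedBall (0 : 𝔼) 2)).exists_bound_of_continuousOn hh₂.continuous.continuousOn
  have hC0 : 0 ≤ C := (norm_nonneg _).trans (hC (0, 0) (by simp))
  refine ⟨C, hC0, fun ε hε hε1 x hx => ?_⟩
  have hfun : truncate η φ (m + 4) ε = fun y => F (ε, ε⁻¹ • y) := by
    funext y
    simp only [truncate, F, smul_inv_smul₀ hε.ne']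
    ring
  have hbi : bilap (fun y => F (ε, y)) (ε⁻¹ • x) =
      η (ε⁻¹ • x) ^ m * h₂ (ε, ε⁻¹ • x) := by
    have hA : ContDiff ℝ (⊤ : ℕ∞) (lapAlong v F) := hF.lapAlong v
    have : lapAlong v (lapAlong v F) = fun z => η z.2 ^ m * h₂ z := by
      rw [← e₂, ← e₁]
    rw [bilap, lap_slice hF, lap_slice hA]
    exact congrFun this _
  rw [hfun, bilap_comp_smul (fun y => F (ε, y)), hbi, abs_mul, abs_mul,
    abs_of_nonneg (pow_nonneg (inv_nonneg.2 hε.le) 4), abs_of_nonneg (pow_nonneg (hη.nonneg _) m)]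
  have hb : |h₂ (ε, ε⁻¹ • x)| ≤ C := by
    refine hC _ ⟨⟨hε.le, hε1⟩, ?_⟩
    rw [mem_closedBall_zero_iff, norm_smul, norm_inv, Real.norm_of_nonneg hε.le,
      inv_mul_le_iff₀ hε]
    linarith
  have := pow_nonneg (hη.nonneg (ε⁻¹ • x)) m
  calc ε⁻¹ ^ 4 * (η (ε⁻¹ • x) ^ m * |h₂ (ε, ε⁻¹ • x)|)
      ≤ ε⁻¹ ^ 4 * (η (ε⁻¹ • x) ^ m * C) := by gcongr
    _ = C * ε⁻¹ ^ 4 * η (ε⁻¹ • x) ^ m := by ring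

theorem norm_inv_smul_of_pos (x : 𝔼) {ε : ℝ} (hε : 0 < ε) : ‖ε⁻¹ • x‖ = ε⁻¹ * ‖x‖ := by
  rw [norm_smul, norm_inv, Real.norm_of_nonneg hε.le]

theorem IsOriginCutoff.eq_zero_of_norm_le {η : 𝔼 → ℝ} (hη : IsOriginCutoff η) {ε : ℝ}
    (hε : 0 < ε) {x : 𝔼} (hx : ‖x‖ ≤ ε) : η (ε⁻¹ • x) = 0 :=
  hη.eq_zero _ (by rw [norm_inv_smul_of_pos x hε, inv_mul_le_iff₀ hε]; simpa using hx)

theorem IsOriginCutoff.eq_one_of_le_norm {η : 𝔼 → ℝ} (hη : IsOriginCutoff η) {ε : ℝ}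
    (hε : 0 < ε) {x : 𝔼} (hx : 2 * ε ≤ ‖x‖) : η (ε⁻¹ • x) = 1 :=
  hη.eq_one _ (by rw [norm_inv_smul_of_pos x hε, le_inv_mul_iff₀ hε]; linarith)

theorem contDiff_truncate {η φ : 𝔼 → ℝ} (hη : IsOriginCutoff η) (hφ : ContDiff ℝ (⊤ : ℕ∞) φ)
    (N : ℕ) (ε : ℝ) : ContDiff ℝ (⊤ : ℕ∞) (truncate η φ N ε) :=
  hφ.mul ((hη.smooth.comp (contDiff_const_smul _)).pow N)

theorem truncate_eq_self {η : 𝔼 → ℝ} (hη : IsOriginCutoff η) (φ : 𝔼 → ℝ) (N : ℕ) {ε : ℝ}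
    (hε : 0 < ε) {x : 𝔼} (hx : 2 * ε ≤ ‖x‖) : truncate η φ N ε x = φ x := by
  simp [truncate, hη.eq_one_of_le_norm hε hx]

theorem abs_truncate_le {η : 𝔼 → ℝ} (hη : IsOriginCutoff η) (φ : 𝔼 → ℝ) (N : ℕ) (ε : ℝ)
    (x : 𝔼) : |truncate η φ N ε x| ≤ |φ x| := by
  rw [truncate, abs_mul, abs_of_nonneg (pow_nonneg (hη.nonneg _) N)]
  exact mul_le_of_le_one_right (abs_nonneg _) (pow_le_one₀ (hη.nonneg _) (hη.le_one _))

theorem bilap_truncate_eq {η : 𝔼 → ℝ} (hη : IsOriginCutoff η) (φ : 𝔼 → ℝ) (N : ℕ) {ε : ℝ}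
    (hε : 0 < ε) {x : 𝔼} (hx : 2 * ε < ‖x‖) : bilap (truncate η φ N ε) x = bilap φ x := by
  refine bilap_congr_nhds ?_
  filter_upwards [continuous_norm.continuousAt.eventually (lt_mem_nhds hx)] with y hy
  exact truncate_eq_self hη φ N hε hy.le

theorem hasCompactSupport_truncate (η : 𝔼 → ℝ) {φ : 𝔼 → ℝ} (hφ : HasCompactSupport φ) (N : ℕ)
    (ε : ℝ) : HasCompactSupport (truncate η φ N ε) :=
  hφ.mul_right

theorem tsupport_truncate_subset {η φ : 𝔼 → ℝ} (hη : IsOriginCutoff η)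
    (hφ : tsupport φ ⊆ ball 0 1) {N : ℕ} (hN : N ≠ 0) {ε : ℝ} (hε : 0 < ε) :
    tsupport (truncate η φ N ε) ⊆ ball 0 1 \ {0} := by
  intro x hx
  refine ⟨hφ (tsupport_mul_subset_left hx), ?_⟩
  rintro rfl
  refine notMem_tsupport_iff_eventuallyEq.2 ?_ hx
  filter_upwards [ball_mem_nhds (0 : 𝔼) hε] with y hy
  simp [truncate, hη.eq_zero_of_norm_le hε (mem_ball_zero_iff.1 hy).le, hN]

theorem tsupport_bilap_subset (f : 𝔼 → ℝ) : tsupport (bilap f) ⊆ tsupport f :=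
  (tsupport_lap_subset _).trans (tsupport_lap_subset f)

end Cutoff

section Estimates

theorem exists_mul_le_eps_rpow_add {p q : ℝ} (hpq : p.HolderConjugate q) {A δ : ℝ} (hA : 0 ≤ A)
    (hδ : 0 < δ) :
    ∃ M : ℝ, 0 ≤ M ∧ ∀ a b : ℝ, 0 ≤ a → 0 ≤ b → A * a * b ≤ δ * a ^ p + M * b ^ q := by
  have hl : 0 < δ ^ p⁻¹ := Real.rpow_pos_of_pos hδ _
  refine ⟨(A * (δ ^ p⁻¹)⁻¹) ^ q, by positivity, fun a b ha hb => ?_⟩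
  have h := Real.young_inequality_of_nonneg (mul_nonneg hl.le ha)
    (mul_nonneg (mul_nonneg hA (inv_nonneg.2 hl.le)) hb) hpq
  rw [Real.mul_rpow hl.le ha, Real.mul_rpow (by positivity) hb, ← Real.rpow_mul hδ.le,
    inv_mul_cancel₀ hpq.ne_zero, Real.rpow_one] at h
  calc A * a * b = δ ^ p⁻¹ * a * (A * (δ ^ p⁻¹)⁻¹ * b) := by field_simp
    _ ≤ _ := h
    _ ≤ _ := add_le_add (div_le_self (by positivity) hpq.lt.le)
        (div_le_self (by positivity) hpq.symm.lt.le)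

variable {n : ℕ}

local notation "𝔼" => EuclideanSpace ℝ (Fin n)

theorem inv_pow_rpow_mul_volume_closedBall_le {q : ℝ} (hq : 4 * q ≤ n) {ε : ℝ} (hε : 0 < ε)
    (hε1 : ε ≤ 1) :
    (ε⁻¹ ^ 4) ^ q * volume.real (closedBall (0 : 𝔼) (2 * ε)) ≤
      2 ^ n * volume.real (ball (0 : 𝔼) 1) := by
  have hvol : volume.real (closedBall (0 : 𝔼) (2 * ε)) =
      (2 * ε) ^ n * volume.real (ball (0 : 𝔼) 1) := by
    rw [measureReal_def, Measure.addHaar_closedBall _ _ (by positivity), ENNReal.toReal_mul,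
      ENNReal.toReal_ofReal (by positivity), finrank_euclideanSpace_fin, measureReal_def]
  have h1 : (ε⁻¹ ^ 4) ^ q * ε ^ n ≤ 1 := by
    rw [← Real.rpow_natCast ε⁻¹, ← Real.rpow_mul (by positivity), Real.inv_rpow hε.le,
      inv_mul_le_iff₀ (by positivity), mul_one, ← Real.rpow_natCast]
    exact Real.rpow_le_rpow_of_exponent_ge hε hε1 (by exact_mod_cast hq)
  rw [hvol, mul_pow]
  calc _ = (ε⁻¹ ^ 4) ^ q * ε ^ n * (2 ^ n * volume.real (ball (0 : 𝔼) 1)) := by ring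
    _ ≤ _ := mul_le_of_le_one_left (by positivity) h1

end Estimates

section PuncturedSolution

variable {n : ℕ}

local notation "𝔼" => EuclideanSpace ℝ (Fin n)

local notation "𝔹" => (ball (0 : EuclideanSpace ℝ (Fin n)) 1 \ {0})

theorem isOpen_puncturedBall : IsOpen 𝔹 := isOpen_ball.sdiff isClosed_singleton

theorem ae_ne_zero (hn : n ≠ 0) : ∀ᵐ x : 𝔼, x ≠ 0 := by
  have : NeZero n := ⟨hn⟩
  exact compl_mem_ae_iff.2 (measure_singleton (0 : 𝔼))

theorem ne_zero_of_four_mul_le {p q : ℝ} (hpq : p.HolderConjugate q) (hq : 4 * q ≤ n) :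
    n ≠ 0 := by
  rintro rfl
  have := hpq.symm.pos
  norm_num at hq
  linarith

theorem exists_scales : ∃ ε : ℕ → ℝ, (∀ k, 0 < ε k) ∧ (∀ k, ε k ≤ 1 / 8) ∧ Antitone ε ∧
    Tendsto ε atTop (nhds 0) := by
  have h : Antitone fun k : ℕ => 1 / 8 * (1 / ((k : ℝ) + 1)) := fun k l hkl =>
    mul_le_mul_of_nonneg_left (one_div_le_one_div_of_le (by positivity) (by gcongr))
      (by norm_num)
  refine ⟨_, fun k => by positivity, fun k => (h k.zero_le).trans (by norm_num), h, ?_⟩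
  simpa only [mul_zero] using
    (tendsto_one_div_add_atTop_nhds_zero_nat (𝕜 := ℝ)).const_mul (1 / 8 : ℝ)

/-- Nonnegative `C⁴` solutions of `Δ²u = u^p` in the punctured unit ball. -/
structure IsPuncturedSolution (p : ℝ) (u : 𝔼 → ℝ) : Prop where
  contDiffAt : ∀ x ∈ 𝔹, ContDiffAt ℝ 4 u x
  nonneg : ∀ x ∈ 𝔹, 0 ≤ u x
  bilap_eq : ∀ x ∈ 𝔹, bilap u x = u x ^ p

namespace IsPuncturedSolution

variable {p : ℝ} {u : EuclideanSpace ℝ (Fin n) → ℝ}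

theorem continuousOn (hu : IsPuncturedSolution p u) : ContinuousOn u 𝔹 :=
  fun x hx => (hu.contDiffAt x hx).continuousAt.continuousWithinAt

theorem continuousOn_rpow (hu : IsPuncturedSolution p u) (hp : 0 ≤ p) :
    ContinuousOn (fun x => u x ^ p) 𝔹 :=
  hu.continuousOn.rpow_const fun _ _ => Or.inr hp

theorem integral_mul_bilap (hu : IsPuncturedSolution p u) {ψ : 𝔼 → ℝ}
    (hψ : ContDiff ℝ (⊤ : ℕ∞) ψ) (hψc : HasCompactSupport ψ) (hψU : tsupport ψ ⊆ 𝔹) :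
    ∫ x, u x * bilap ψ x = ∫ x, u x ^ p * ψ x := by
  rw [_root_.integral_mul_bilap isOpen_puncturedBall hu.contDiffAt hψ hψc hψU]
  refine integral_congr_ae (ae_of_all _ fun x => ?_)
  by_cases hx : x ∈ 𝔹
  · simp only [hu.bilap_eq x hx]
  · simp [image_eq_zero_of_notMem_tsupport fun h => hx (hψU h)]

theorem integrable_mul_bilap (hu : IsPuncturedSolution p u) {ψ : 𝔼 → ℝ}
    (hψ : ContDiff ℝ (⊤ : ℕ∞) ψ) (hψc : HasCompactSupport ψ) (hψU : tsupport (bilap ψ) ⊆ 𝔹) :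
    Integrable (fun x => u x * bilap ψ x) :=
  integrable_mul_of_tsupport_subset isOpen_puncturedBall hu.continuousOn hψ.lap.lap.continuous
    hψc.lap.lap hψU

/-- A bump function supported in the unit ball and equal to one on the ball of radius `1 / 2`. -/
theorem exists_unit_bump (n : ℕ) :
    ∃ φ : EuclideanSpace ℝ (Fin n) → ℝ, ContDiff ℝ (⊤ : ℕ∞) φ ∧ HasCompactSupport φ ∧
      tsupport φ ⊆ ball 0 1 ∧ (∀ x, 0 ≤ φ x) ∧ ∀ x, ‖x‖ ≤ 1 / 2 → φ x = 1 := by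
  let b : ContDiffBump (0 : EuclideanSpace ℝ (Fin n)) :=
    ⟨1 / 2, 3 / 4, by norm_num, by norm_num⟩
  refine ⟨b, b.contDiff, b.hasCompactSupport, ?_, fun x => b.nonneg, fun x hx =>
    b.one_of_mem_closedBall (mem_closedBall_zero_iff.2 hx)⟩
  rw [b.tsupport_eq]
  exact closedBall_subset_ball (by norm_num)

theorem rpow_mul_truncate_nonneg (hu : IsPuncturedSolution p u) {η φ : 𝔼 → ℝ}
    (hη : IsOriginCutoff η) (hφ0 : ∀ x, 0 ≤ φ x) (hφ : tsupport φ ⊆ ball 0 1) {N : ℕ}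
    (hN : N ≠ 0) {ε : ℝ} (hε : 0 < ε) (x : 𝔼) : 0 ≤ u x ^ p * truncate η φ N ε x := by
  by_cases hx : x ∈ 𝔹
  · exact mul_nonneg (Real.rpow_nonneg (hu.nonneg x hx) p)
      (mul_nonneg (hφ0 x) (pow_nonneg (hη.nonneg _) N))
  · simp [image_eq_zero_of_notMem_tsupport fun h => hx (tsupport_truncate_subset hη hφ hN hε h)]

theorem integrable_rpow_mul_truncate (hu : IsPuncturedSolution p u) (hp : 0 ≤ p)
    {η φ : 𝔼 → ℝ} (hη : IsOriginCutoff η) (hφs : ContDiff ℝ (⊤ : ℕ∞) φ)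
    (hφc : HasCompactSupport φ) (hφ : tsupport φ ⊆ ball 0 1) {N : ℕ}
    (hN : N ≠ 0) {ε : ℝ} (hε : 0 < ε) :
    Integrable (fun x => u x ^ p * truncate η φ N ε x) :=
  integrable_mul_of_tsupport_subset isOpen_puncturedBall (hu.continuousOn_rpow hp)
    (contDiff_truncate hη hφs N ε).continuous (hasCompactSupport_truncate η hφc N ε)
    (tsupport_truncate_subset hη hφ hN hε)

/-- The energy estimate: the integrals of `u ^ p` against truncated bumps are bounded uniformly
in the truncation scale. -/
theorem exists_integral_rpow_mul_truncate_le (hu : IsPuncturedSolution p u) {q : ℝ}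
    (hpq : p.HolderConjugate q) (hq : 4 * q ≤ n) {m : ℕ} (hm : (m + 4 : ℝ) ≤ m * p)
    {η φ : 𝔼 → ℝ} (hη : IsOriginCutoff η) (hφs : ContDiff ℝ (⊤ : ℕ∞) φ)
    (hφc : HasCompactSupport φ) (hφ : tsupport φ ⊆ ball 0 1) (hφ0 : ∀ x, 0 ≤ φ x)
    (hφ1 : ∀ x, ‖x‖ ≤ 1 / 2 → φ x = 1) :
    ∃ K : ℝ, ∀ ε : ℝ, 0 < ε → ε ≤ 1 / 8 →
      ∫ x, u x ^ p * truncate η φ (m + 4) ε x ≤ K := by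
  obtain ⟨C, hC0, hC⟩ := exists_abs_bilap_cutoff_le hη hφs m
  obtain ⟨M, hM0, hM⟩ := exists_mul_le_eps_rpow_add hpq hC0 (half_pos one_pos)
  have hφb : tsupport (bilap φ) ⊆ 𝔹 := by
    intro x hx
    refine ⟨hφ (tsupport_bilap_subset φ hx), ?_⟩
    rintro rfl
    refine notMem_tsupport_iff_eventuallyEq.2 ?_ hx
    filter_upwards [ball_mem_nhds (0 : 𝔼) (show (0 : ℝ) < 1 / 2 by norm_num)] with y hy
    have : φ =ᶠ[nhds y] fun _ => 1 := by
      filter_upwards [isOpen_ball.mem_nhds hy] with z hz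
      exact hφ1 z (mem_ball_zero_iff.1 hz).le
    rw [bilap_congr_nhds this]
    simp [bilap, lap_const]
  have hG := (hu.integrable_mul_bilap hφs hφc hφb).abs
  let V := volume.real (ball (0 : 𝔼) 1)
  refine ⟨2 * ((∫ x, |u x * bilap φ x|) + M * (2 ^ n * V)), fun ε hε hε8 => ?_⟩
  have hN : m + 4 ≠ 0 := by omega
  let ψ := truncate η φ (m + 4) ε
  have hψs : ContDiff ℝ (⊤ : ℕ∞) ψ := contDiff_truncate hη hφs _ ε
  have hψc : HasCompactSupport ψ := hasCompactSupport_truncate η hφc _ ε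
  have hψU : tsupport ψ ⊆ 𝔹 := tsupport_truncate_subset hη hφ hN hε
  have hψ0 : ∀ x, 0 ≤ u x ^ p * ψ x := hu.rpow_mul_truncate_nonneg hη hφ0 hφ hN hε
  have hψi : Integrable (fun x => u x ^ p * ψ x) :=
    hu.integrable_rpow_mul_truncate hpq.nonneg hη hφs hφc hφ hN hε
  have hint : IntegrableOn (fun _ : 𝔼 => M * (ε⁻¹ ^ 4) ^ q) (closedBall 0 (2 * ε)) :=
    integrableOn_const measure_closedBall_lt_top.ne
  let R : 𝔼 → ℝ := (closedBall (0 : 𝔼) (2 * ε)).indicator fun _ => M * (ε⁻¹ ^ 4) ^ q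
  have hRi : Integrable R := hint.integrable_indicator measurableSet_closedBall
  have hR0 : ∀ x, 0 ≤ R x := Set.indicator_nonneg fun _ _ => by positivity
  have hpt : ∀ x, u x * bilap ψ x ≤ |u x * bilap φ x| + 1 / 2 * (u x ^ p * ψ x) + R x := by
    intro x
    by_cases hx : x ∈ 𝔹
    · have hux := hu.nonneg x hx
      rcases le_or_gt ‖x‖ (2 * ε) with hxε | hxε
      · have hR : R x = M * (ε⁻¹ ^ 4) ^ q :=
          Set.indicator_of_mem (mem_closedBall_zero_iff.2 hxε) _
        have hη0 := hη.nonneg (ε⁻¹ • x)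
        have h1 : u x * bilap ψ x ≤ C * (u x * η (ε⁻¹ • x) ^ m) * ε⁻¹ ^ 4 :=
          calc u x * bilap ψ x ≤ u x * (C * ε⁻¹ ^ 4 * η (ε⁻¹ • x) ^ m) :=
                mul_le_mul_of_nonneg_left
                  ((le_abs_self _).trans (hC ε hε (by linarith) x hxε)) hux
            _ = _ := by ring
        have h2 := hM (u x * η (ε⁻¹ • x) ^ m) (ε⁻¹ ^ 4) (by positivity) (by positivity)
        have h3 : (u x * η (ε⁻¹ • x) ^ m) ^ p ≤ u x ^ p * ψ x := by
          rw [Real.mul_rpow hux (by positivity)]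
          refine mul_le_mul_of_nonneg_left ?_ (Real.rpow_nonneg hux p)
          simp only [ψ, truncate, hφ1 x (by linarith), one_mul]
          rw [← Real.rpow_natCast, ← Real.rpow_mul hη0, ← Real.rpow_natCast]
          exact Real.rpow_le_rpow_of_exponent_ge_of_imp hη0 (hη.le_one _)
            (by push_cast; exact hm) (fun _ h => by
              have : (0 : ℝ) ≤ m := by positivity
              linarith)
        have h4 := abs_nonneg (u x * bilap φ x)
        rw [hR]
        linarith
      · rw [bilap_truncate_eq hη φ _ hε hxε]
        have h1 := le_abs_self (u x * bilap φ x)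
        have h2 := hψ0 x
        have h3 := hR0 x
        linarith
    · have hx' : x ∉ tsupport (bilap ψ) := fun h => hx (hψU (tsupport_bilap_subset ψ h))
      rw [image_eq_zero_of_notMem_tsupport hx', mul_zero]
      have h1 := abs_nonneg (u x * bilap φ x)
      have h2 := hψ0 x
      have h3 := hR0 x
      linarith
  have hS : Integrable (fun x => |u x * bilap φ x| + 1 / 2 * (u x ^ p * ψ x)) :=
    hG.add (hψi.const_mul (1 / 2))
  have hmono := integral_mono
    (hu.integrable_mul_bilap hψs hψc ((tsupport_bilap_subset ψ).trans hψU)) (hS.add hRi) hpt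
  rw [integral_add' hS hRi, integral_add hG (hψi.const_mul (1 / 2)), integral_const_mul,
    hu.integral_mul_bilap hψs hψc hψU, integral_indicator measurableSet_closedBall,
    setIntegral_const, smul_eq_mul] at hmono
  have hv := mul_le_mul_of_nonneg_left
    (inv_pow_rpow_mul_volume_closedBall_le (n := n) hq hε (by linarith)) hM0
  change ∫ x, u x ^ p * ψ x ≤ _
  linarith [hv, hmono]

theorem integrableOn_rpow_ball (hu : IsPuncturedSolution p u) {q : ℝ}
    (hpq : p.HolderConjugate q) (hq : 4 * q ≤ n) {m : ℕ} (hm : (m + 4 : ℝ) ≤ m * p)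
    {η : 𝔼 → ℝ} (hη : IsOriginCutoff η) :
    IntegrableOn (fun x => u x ^ p) (ball 0 (1 / 2)) := by
  have hn0 : n ≠ 0 := ne_zero_of_four_mul_le hpq hq
  obtain ⟨φ, hφs, hφc, hφ, hφ0, hφ1⟩ := exists_unit_bump n
  obtain ⟨K, hK⟩ := hu.exists_integral_rpow_mul_truncate_le hpq hq hm hη hφs hφc hφ hφ0 hφ1
  have hN : m + 4 ≠ 0 := by omega
  obtain ⟨ε, hε, hε8, -, hεt⟩ := exists_scales
  let s : ℕ → Set 𝔼 := fun k => {x | 2 * ε k ≤ ‖x‖}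
  have hs : ∀ k, MeasurableSet (s k) := fun k =>
    (isClosed_le continuous_const continuous_norm).measurableSet
  have hcover : AECover volume atTop s :=
    { ae_eventually_mem := by
        filter_upwards [ae_ne_zero hn0] with x hx
        have h2 : Tendsto (fun k => 2 * ε k) atTop (nhds 0) := by
          simpa using hεt.const_mul 2
        exact (h2.eventually (gt_mem_nhds (norm_pos_iff.2 hx))).mono fun _ h => h.le
      measurableSet := hs }
  have hcongr : ∀ k, Set.EqOn (fun x => u x ^ p * truncate η φ (m + 4) (ε k) x)
      (fun x => u x ^ p * φ x) (s k) := fun k x hx => by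
    simp only [truncate_eq_self hη φ (m + 4) (hε k) hx]
  have hi := fun k => hu.integrable_rpow_mul_truncate hpq.nonneg hη hφs hφc hφ hN (hε k)
  have hint : Integrable (fun x => u x ^ p * φ x) := by
    refine hcover.integrable_of_integral_bounded_of_nonneg_ae K
      (fun k => (hi k).integrableOn.congr_fun (hcongr k) (hs k)) ?_
      (Eventually.of_forall fun k => ?_)
    · filter_upwards [ae_ne_zero hn0] with x hx
      by_cases hx1 : x ∈ ball 0 1
      · exact mul_nonneg (Real.rpow_nonneg (hu.nonneg x ⟨hx1, hx⟩) p) (hφ0 x)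
      · simp [image_eq_zero_of_notMem_tsupport fun h => hx1 (hφ h)]
    · rw [← setIntegral_congr_fun (hs k) (hcongr k)]
      exact (setIntegral_le_integral (hi k)
        (ae_of_all _ (hu.rpow_mul_truncate_nonneg hη hφ0 hφ hN (hε k)))).trans
        (hK _ (hε k) (hε8 k))
  refine hint.integrableOn.congr_fun (fun x hx => ?_) measurableSet_ball
  simp [hφ1 x (mem_ball_zero_iff.1 hx).le]

theorem locallyIntegrableOn_rpow (hu : IsPuncturedSolution p u) (hp : 0 ≤ p)
    (h : IntegrableOn (fun x => u x ^ p) (ball 0 (1 / 2))) :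
    LocallyIntegrableOn (fun x => u x ^ p) (ball 0 1) := by
  intro x hx
  rcases eq_or_ne x 0 with rfl | hx0
  · exact ⟨_, mem_nhdsWithin_of_mem_nhds (ball_mem_nhds 0 (by norm_num)), h⟩
  · have hxU : x ∈ 𝔹 := ⟨hx, hx0⟩
    have := (hu.continuousOn_rpow hp).locallyIntegrableOn (μ := volume)
      isOpen_puncturedBall.measurableSet x hxU
    rw [isOpen_puncturedBall.nhdsWithin_eq hxU] at this
    exact this.filter_mono nhdsWithin_le_nhds

theorem integrable_rpow_mul (hloc : LocallyIntegrableOn (fun x => u x ^ p) (ball 0 1))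
    {g : 𝔼 → ℝ} (hg : Continuous g) (hgc : HasCompactSupport g) (hgU : tsupport g ⊆ ball 0 1) :
    Integrable (fun x => u x ^ p * g x) := by
  have h := (hloc.integrableOn_compact_subset hgU hgc).mul_continuousOn hg.continuousOn hgc
  rwa [integrableOn_iff_integrable_of_support_subset] at h
  exact fun x hx => subset_tsupport g (right_ne_zero_of_mul hx)

theorem integrable_mul (hu : IsPuncturedSolution p u) (hn : n ≠ 0) (hp : 1 ≤ p)
    (hloc : LocallyIntegrableOn (fun x => u x ^ p) (ball 0 1))
    {g : 𝔼 → ℝ} (hg : Continuous g) (hgc : HasCompactSupport g) (hgU : tsupport g ⊆ ball 0 1) :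
    Integrable (fun x => u x * g x) := by
  have hoff : ∀ x, x ≠ 0 → x ∉ 𝔹 → g x = 0 := fun x hx0 hx =>
    image_eq_zero_of_notMem_tsupport fun h => hx ⟨hgU h, hx0⟩
  refine ((hg.integrable_of_hasCompactSupport hgc).abs.add
    (integrable_rpow_mul hloc hg hgc hgU).abs).mono' ?_ ?_
  · have h1 : AEStronglyMeasurable (Set.indicator 𝔹 fun x => u x * g x) volume :=
      (aestronglyMeasurable_indicator_iff isOpen_puncturedBall.measurableSet).2
        ((hu.continuousOn.mul hg.continuousOn).aestronglyMeasurable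
          isOpen_puncturedBall.measurableSet)
    refine h1.congr ?_
    filter_upwards [ae_ne_zero hn] with x hx
    by_cases hxU : x ∈ 𝔹
    · exact Set.indicator_of_mem hxU _
    · rw [Set.indicator_of_notMem hxU, hoff x hx hxU, mul_zero]
  · filter_upwards [ae_ne_zero hn] with x hx
    by_cases hxU : x ∈ 𝔹
    · have hux := hu.nonneg x hxU
      have hup := Real.rpow_nonneg hux p
      have hle : u x ≤ 1 + u x ^ p := by
        rcases le_total (u x) 1 with h | h
        · linarith
        · have := Real.rpow_le_rpow_of_exponent_le h hp
          rw [Real.rpow_one] at this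
          linarith
      simp only [Pi.add_apply, Real.norm_eq_abs, abs_mul, abs_of_nonneg hux, abs_of_nonneg hup]
      nlinarith [abs_nonneg (g x)]
    · simp [hoff x hx hxU]

/-- Replacing a test function by its truncation at scale `ε` changes `∫ u Δ²φ` by an amount
controlled by the mass of `u ^ p` near the origin. -/
theorem exists_abs_integral_sub_le (hu : IsPuncturedSolution p u) {q : ℝ}
    (hpq : p.HolderConjugate q) (hq : 4 * q ≤ n)
    (hloc : LocallyIntegrableOn (fun x => u x ^ p) (ball 0 1)) (m : ℕ)
    {η φ : 𝔼 → ℝ} (hη : IsOriginCutoff η) (hφs : ContDiff ℝ (⊤ : ℕ∞) φ)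
    (hφc : HasCompactSupport φ) (hφ : tsupport φ ⊆ ball 0 1) {δ : ℝ} (hδ : 0 < δ) :
    ∃ M : ℝ, ∀ ε : ℝ, 0 < ε → ε ≤ 1 / 8 →
      |(∫ x, u x * bilap φ x) - ∫ x, u x ^ p * truncate η φ (m + 4) ε x| ≤
        M * (∫ x in closedBall 0 (2 * ε), u x ^ p) +
          δ * (2 ^ n * volume.real (ball (0 : 𝔼) 1)) := by
  have hn0 : n ≠ 0 := ne_zero_of_four_mul_le hpq hq
  obtain ⟨C, hC0, hC⟩ := exists_abs_bilap_cutoff_le hη hφs m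
  obtain ⟨B, hB⟩ := hφs.lap.lap.continuous.bounded_above_of_compact_support hφc.lap.lap
  have hB0 : 0 ≤ B := (norm_nonneg _).trans (hB 0)
  obtain ⟨M, hM0, hM⟩ := exists_mul_le_eps_rpow_add hpq.symm (add_nonneg hB0 hC0) hδ
  refine ⟨M, fun ε hε hε8 => ?_⟩
  have hN : m + 4 ≠ 0 := by omega
  let ψ := truncate η φ (m + 4) ε
  have hψs : ContDiff ℝ (⊤ : ℕ∞) ψ := contDiff_truncate hη hφs _ ε
  have hψc : HasCompactSupport ψ := hasCompactSupport_truncate η hφc _ ε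
  have hψU : tsupport ψ ⊆ 𝔹 := tsupport_truncate_subset hη hφ hN hε
  have hsub : closedBall (0 : 𝔼) (2 * ε) ⊆ ball 0 1 :=
    closedBall_subset_ball (by linarith)
  have hint1 : IntegrableOn (fun x => u x ^ p) (closedBall 0 (2 * ε)) :=
    hloc.integrableOn_compact_subset hsub (isCompact_closedBall 0 _)
  have hint2 : IntegrableOn (fun _ : 𝔼 => δ * (ε⁻¹ ^ 4) ^ q) (closedBall 0 (2 * ε)) :=
    integrableOn_const measure_closedBall_lt_top.ne
  have hint : IntegrableOn (fun x => M * u x ^ p + δ * (ε⁻¹ ^ 4) ^ q) (closedBall 0 (2 * ε)) :=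
    (hint1.const_mul M).add hint2
  have hφi : Integrable (fun x => u x * bilap φ x) :=
    hu.integrable_mul hn0 hpq.lt.le hloc hφs.lap.lap.continuous hφc.lap.lap
      ((tsupport_bilap_subset φ).trans hφ)
  rw [← hu.integral_mul_bilap hψs hψc hψU, ← integral_sub hφi
    (hu.integrable_mul_bilap hψs hψc ((tsupport_bilap_subset ψ).trans hψU)), ← Real.norm_eq_abs]
  have hbound := norm_integral_le_of_norm_le (hint.integrable_indicator measurableSet_closedBall)
    (f := fun x => u x * bilap φ x - u x * bilap ψ x) (by
      filter_upwards [ae_ne_zero hn0] with x hx0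
      rw [← mul_sub, norm_mul, Real.norm_eq_abs, Real.norm_eq_abs]
      rcases le_or_gt ‖x‖ (2 * ε) with hxε | hxε
      · have hxb : x ∈ closedBall (0 : 𝔼) (2 * ε) := mem_closedBall_zero_iff.2 hxε
        rw [Set.indicator_of_mem hxb]
        have hux := hu.nonneg x ⟨hsub hxb, hx0⟩
        have hε1 : 1 ≤ ε⁻¹ ^ 4 := one_le_pow₀ ((one_le_inv₀ hε).2 (by linarith))
        have h1 : |bilap φ x - bilap ψ x| ≤ B * ε⁻¹ ^ 4 + C * ε⁻¹ ^ 4 := by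
          refine (abs_sub _ _).trans (add_le_add ((hB x).trans ?_) ?_)
          · exact le_mul_of_one_le_right hB0 hε1
          · exact (hC ε hε (by linarith) x hxε).trans
              (mul_le_of_le_one_right (by positivity) (pow_le_one₀ (hη.nonneg _) (hη.le_one _)))
        rw [abs_of_nonneg hux]
        calc u x * |bilap φ x - bilap ψ x| ≤ u x * (B * ε⁻¹ ^ 4 + C * ε⁻¹ ^ 4) := by gcongr
          _ = (B + C) * ε⁻¹ ^ 4 * u x := by ring
          _ ≤ δ * (ε⁻¹ ^ 4) ^ q + M * u x ^ p := hM _ _ (by positivity) hux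
          _ = _ := add_comm _ _
      · rw [Set.indicator_of_notMem (by simpa using hxε),
          bilap_truncate_eq hη φ _ hε hxε]
        simp)
  refine hbound.trans ?_
  rw [integral_indicator measurableSet_closedBall, integral_add (hint1.const_mul M) hint2,
    integral_const_mul, setIntegral_const, smul_eq_mul]
  have hv := mul_le_mul_of_nonneg_left
    (inv_pow_rpow_mul_volume_closedBall_le (n := n) hq hε (by linarith)) hδ.le
  linarith

theorem integral_mul_bilap_eq (hu : IsPuncturedSolution p u) {q : ℝ}
    (hpq : p.HolderConjugate q) (hq : 4 * q ≤ n)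
    (hloc : LocallyIntegrableOn (fun x => u x ^ p) (ball 0 1)) {φ : 𝔼 → ℝ}
    (hφs : ContDiff ℝ (⊤ : ℕ∞) φ) (hφc : HasCompactSupport φ) (hφ : tsupport φ ⊆ ball 0 1) :
    ∫ x, u x * bilap φ x = ∫ x, u x ^ p * φ x := by
  have hn0 : n ≠ 0 := ne_zero_of_four_mul_le hpq hq
  obtain ⟨η, hη⟩ := exists_isOriginCutoff n
  obtain ⟨ε, hε, hε8, hεa, hεt⟩ := exists_scales
  have h2ε : Tendsto (fun k => 2 * ε k) atTop (nhds 0) := by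
    simpa using hεt.const_mul 2
  have hfar : ∀ x : 𝔼, x ≠ 0 → ∀ᶠ k in atTop, 2 * ε k < ‖x‖ := fun x hx =>
    h2ε.eventually (gt_mem_nhds (norm_pos_iff.2 hx))
  have hlim : Tendsto (fun k => ∫ x, u x ^ p * truncate η φ (0 + 4) (ε k) x) atTop
      (nhds (∫ x, u x ^ p * φ x)) := by
    refine tendsto_integral_of_dominated_convergence (fun x => |u x ^ p * φ x|)
      (fun k => (hu.integrable_rpow_mul_truncate hpq.nonneg hη hφs hφc hφ (by norm_num)
        (hε k)).aestronglyMeasurable)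
      (integrable_rpow_mul hloc hφs.continuous hφc hφ).abs (fun k => ae_of_all _ fun x => ?_) ?_
    · rw [Real.norm_eq_abs, abs_mul, abs_mul]
      exact mul_le_mul_of_nonneg_left (abs_truncate_le hη φ _ _ x) (abs_nonneg _)
    · filter_upwards [ae_ne_zero hn0] with x hx
      refine tendsto_const_nhds.congr' ?_
      filter_upwards [hfar x hx] with k hk
      rw [truncate_eq_self hη φ _ (hε k) hk.le]
  have hmass : Tendsto (fun k => ∫ x in closedBall (0 : 𝔼) (2 * ε k), u x ^ p) atTop
      (nhds 0) := by
    have hsub : closedBall (0 : 𝔼) (2 * ε 0) ⊆ ball 0 1 :=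
      closedBall_subset_ball (by linarith [hε8 0])
    have h := tendsto_setIntegral_of_antitone (μ := volume) (f := fun x => u x ^ p)
      (s := fun k => closedBall (0 : 𝔼) (2 * ε k)) (fun _ => measurableSet_closedBall)
      (fun k l hkl => closedBall_subset_closedBall (by linarith [hεa hkl]))
      ⟨0, hloc.integrableOn_compact_subset hsub (isCompact_closedBall 0 _)⟩
    have hzero : volume (⋂ k, closedBall (0 : 𝔼) (2 * ε k)) = 0 := by
      refine measure_mono_null (t := {x : 𝔼 | x ≠ 0}ᶜ) (fun x hx (h0 : x ≠ 0) => ?_)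
        (ae_ne_zero hn0)
      obtain ⟨k, hk⟩ := (hfar x h0).exists
      exact absurd (mem_closedBall_zero_iff.1 (Set.mem_iInter.1 hx k)) (not_le.2 hk)
    rwa [setIntegral_measure_zero _ hzero] at h
  set L := ∫ x, u x * bilap φ x
  set R := ∫ x, u x ^ p * φ x
  set V := 2 ^ n * volume.real (ball (0 : 𝔼) 1)
  have hV : 0 ≤ V := by positivity
  have hδ : ∀ δ : ℝ, 0 < δ → |L - R| ≤ δ * V := fun δ hδ => by
    obtain ⟨M, hM⟩ := hu.exists_abs_integral_sub_le hpq hq hloc 0 hη hφs hφc hφ hδ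
    have h := le_of_tendsto_of_tendsto' (tendsto_const_nhds.sub hlim).abs
      ((hmass.const_mul M).add tendsto_const_nhds) fun k => hM (ε k) (hε k) (hε8 k)
    simpa using h
  have h0 : Tendsto (fun δ : ℝ => δ * V) (nhdsWithin 0 (Set.Ioi 0)) (nhds 0) := by
    have : Tendsto (fun δ : ℝ => δ * V) (nhds 0) (nhds (0 * V)) := tendsto_id.mul_const V
    rw [zero_mul] at this
    exact this.mono_left nhdsWithin_le_nhds
  have hle : |L - R| ≤ 0 := ge_of_tendsto h0 (eventually_nhdsWithin_of_forall hδ)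
  exact sub_eq_zero.1 (abs_nonpos_iff.1 hle)

end IsPuncturedSolution

end PuncturedSolution

/-- For `p ≥ n/(n-4)`, any nonnegative `C⁴` solution of `Δ²u = u^p` in the
punctured unit ball satisfies `u^p ∈ L¹_loc(B₁)` and is a distribution solution in `B₁`. -/
theorem stmt_6 (n : ℕ) (hn : 5 ≤ n) (p : ℝ)
    (hp : (n : ℝ) / ((n : ℝ) - 4) ≤ p)
    (u : EuclideanSpace ℝ (Fin n) → ℝ)
    (hreg : ContDiffOn ℝ 4 u (ball 0 1 \ {0}))
    (hpos : ∀ x ∈ ball (0 : EuclideanSpace ℝ (Fin n)) 1 \ {0}, 0 ≤ u x)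
    (heq : ∀ x ∈ ball (0 : EuclideanSpace ℝ (Fin n)) 1 \ {0}, bilap u x = u x ^ p) :
    LocallyIntegrableOn (fun x => u x ^ p) (ball 0 1) volume ∧
    ∀ φ : EuclideanSpace ℝ (Fin n) → ℝ, ContDiff ℝ (⊤ : ℕ∞) φ → HasCompactSupport φ →
      tsupport φ ⊆ ball 0 1 →
      ∫ x in ball (0 : EuclideanSpace ℝ (Fin n)) 1, u x * bilap φ x =
        ∫ x in ball (0 : EuclideanSpace ℝ (Fin n)) 1, u x ^ p * φ x := by
  have hn4 : (0 : ℝ) < n - 4 := by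
    have : (5 : ℝ) ≤ n := by exact_mod_cast hn
    linarith
  have hnp : (n : ℝ) ≤ p * (n - 4) := (div_le_iff₀ hn4).1 hp
  have hp1 : 1 < p := by
    refine lt_of_lt_of_le ?_ hp
    rw [lt_div_iff₀ hn4]
    linarith
  have hpq : p.HolderConjugate (p / (p - 1)) := Real.HolderConjugate.conjExponent hp1
  have hq : 4 * (p / (p - 1)) ≤ n := by
    rw [← mul_div_assoc, div_le_iff₀ (by linarith)]
    linarith
  obtain ⟨m, hm⟩ := exists_nat_ge (4 / (p - 1))
  rw [div_le_iff₀ (by linarith)] at hm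
  obtain ⟨η, hη⟩ := exists_isOriginCutoff n
  have hu : IsPuncturedSolution p u :=
    ⟨fun x hx => hreg.contDiffAt (isOpen_puncturedBall.mem_nhds hx), hpos, heq⟩
  have hloc := hu.locallyIntegrableOn_rpow hpq.nonneg
    (hu.integrableOn_rpow_ball hpq hq (m := m) (by linarith) hη)
  refine ⟨hloc, fun φ hφs hφc hφ => ?_⟩
  rw [setIntegral_eq_integral_of_forall_compl_eq_zero fun x hx => by
      rw [image_eq_zero_of_notMem_tsupport fun h => hx (hφ (tsupport_bilap_subset φ h)), mul_zero],
    setIntegral_eq_integral_of_forall_compl_eq_zero fun x hx => by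
      rw [image_eq_zero_of_notMem_tsupport fun h => hx (hφ h), mul_zero]]
  exact hu.integral_mul_bilap_eq hpq hq hloc hφs hφc hφ
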